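/- arXiv:2202.06758 — 3 statements merged into one kernel-verified Lean document; each statement's English description precedes it below -/
import Mathlib

section
/- Twisted form of the syndrome equations: for every integer l ≥ 1, applying σ^{l-1} to the syndrome coefficient s_l gives σ^{l-1}(s_l) = Σ_{i=1}^ℓ Σ_{r=1}^{t_i} x_r^{(i)} · σ^{l-1}(a_r^{(i)}) · ∏_{j=0}^{l-2} σ^{j}(ξ_i). Equivalently, writing s̃ := (s_1, σ(s_2), …, σ^{n-k-1}(s_{n-k})), the error locators satisfy the generalized Moore system A·x^T = s̃^T where A is the Moore matrix built from the error values a_r^{(i)} with parameters ξ_i and automorphism σ. -/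
/-- Cancelling `j` of the `n` applications of a ring automorphism against its inverse. -/
theorem RingEquiv.pow_apply_symm_pow_apply {R : Type*} [Semiring R] (σ : R ≃+* R) {j n : ℕ}
    (h : j ≤ n) (c : R) : (σ ^ n) ((σ.symm ^ j) c) = (σ ^ (n - j)) c := by
  have key : σ ^ n * σ⁻¹ ^ j = σ ^ (n - j) := by
    rw [inv_pow, pow_sub σ h]
  exact DFunLike.congr_fun key c

/-- Applying `σ ^ n` to `∏_{j=1}^{n} σ^{-j}(c)` gives `∏_{j=0}^{n-1} σ^j(c)`. -/
theorem RingEquiv.pow_apply_prod_symm_pow {R : Type*} [CommSemiring R] (σ : R ≃+* R) (n : ℕ)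
    (c : R) : (σ ^ n) (∏ j ∈ Finset.Icc 1 n, (σ.symm ^ j) c) =
      ∏ j ∈ Finset.range n, (σ ^ j) c := by
  rw [map_prod]
  refine Finset.prod_nbij' (n - ·) (n - ·) ?_ ?_ ?_ ?_ fun j hj =>
    σ.pow_apply_symm_pow_apply (Finset.mem_Icc.1 hj).2 c
  all_goals
    intro j hj
    simp only [Finset.mem_Icc, Finset.mem_range] at *
    omega

/-- Twisted form of the syndrome equations: applying `σ^{l-1}` to the `l`-th syndrome
coefficient `s_l = ∑_{i,r} a_r^{(i)} · σ^{-(l-1)}(x_r^{(i)}) · ∏_{j=1}^{l-1} σ^{-j}(ξ_i)`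
gives `σ^{l-1}(s_l) = ∑_{i,r} x_r^{(i)} · σ^{l-1}(a_r^{(i)}) · ∏_{j=0}^{l-2} σ^{j}(ξ_i)`,
i.e. the error locators satisfy the generalized Moore system `A xᵀ = s̃ᵀ` where `A` is the
Moore matrix built from the error values with parameters `ξ_i` and automorphism `σ`. -/
theorem twisted_syndrome_equations {K : Type*} [Field K] (σ : K ≃+* K)
    (ℓ : ℕ) (t : Fin ℓ → ℕ)
    (ξ : Fin ℓ → K) (hξ : ∀ i, ξ i ≠ 0)
    (a x : (i : Fin ℓ) → Fin (t i) → K)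
    (s : ℕ → K)
    (hs : ∀ l : ℕ, 1 ≤ l → s l =
      ∑ i, ∑ r, a i r * (σ.symm ^ (l - 1)) (x i r) *
        ∏ j ∈ Finset.Icc 1 (l - 1), (σ.symm ^ j) (ξ i)) :
    ∀ l : ℕ, 1 ≤ l →
      (σ ^ (l - 1)) (s l)
        = ∑ i, ∑ r, x i r * (σ ^ (l - 1)) (a i r) *
          ∏ j ∈ Finset.range (l - 1), (σ ^ j) (ξ i) := by
  intro l hl
  rw [hs l hl]
  simp only [map_sum, map_mul, RingEquiv.pow_apply_prod_symm_pow,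
    RingEquiv.pow_apply_symm_pow_apply σ le_rfl, Nat.sub_self, pow_zero, RingAut.one_apply]
  refine Finset.sum_congr rfl fun i _ => Finset.sum_congr rfl fun r _ => ?_
  rw [mul_comm (x i r)]
end

section
/- ESP key equation (Theorem 1): for each i partition the index set {1, …, t_i} into sets F_i (full errors), R_i (row erasures) and C_i (column erasures) of sizes t_{F,i}, ρ_i, γ_i, and put t_F = Σ_i t_{F,i}, ρ = Σ_i ρ_i, γ = Σ_i γ_i. Let Λ_{F,1}, …, Λ_{F,t_F+1} ∈ K and Λ_{R,1}, …, Λ_{R,ρ+1} ∈ K and define their skew product λ with respect to σ^{-1} by λ_ν := Σ_{μ} Λ_{F,μ} · σ^{-(μ-1)}(Λ_{R,ν-μ+1}) for ν = 1, …, t_F+ρ+1, and let Λ_{C,1}, …, Λ_{C,γ+1} ∈ K. Assume: (i) Σ_{ν=1}^{t_F+ρ+1} λ_ν · σ^{-(ν-1)}(a_r^{(i)}) · ∏_{j=1}^{ν-1} σ^{-j}(ξ_i)^{-1} = 0 for every i and every r ∈ F_i ∪ R_i; and (ii) Σ_{μ=1}^{γ+1} Λ_{C,μ} · σ^{-(μ-1)}(x_r^{(i)})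 · ∏_{j=1}^{μ-1} σ^{-j}(ξ_i) = 0 for every i and every r ∈ C_i. Then, with u_μ := Σ_{ν=1}^{t_F+ρ+1} λ_ν · σ^{-(ν-1)}(s_{μ-ν+1}), for every integer l ≥ t_F+ρ+γ+1: Σ_{ν=1}^{γ+1} u_{l-ν+1} · σ^{γ+1-l}(Λ_{C,γ-ν+2}) = 0. Equivalently, the skew product Λ_F · (Λ_R · s · Λ̂_C) (with respect to σ^{-1}, where Λ̂_C is the σ^{-1}-reverse of Λ_C with respect to γ) is congruent, modulo x^{n-k} from the right, to a skew polynomial ω of degree less than t_F + ρ + γ. -/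
/-- Cocycle identity for the products `∏_{j=1}^n τ^j(c)`. -/
theorem prod_pow_apply_add {K : Type*} [Field K] (τ : K ≃+* K) (c : K) (m k : ℕ) :
    ∏ j ∈ Finset.Icc 1 (m + k), (τ ^ j) c =
      (∏ j ∈ Finset.Icc 1 m, (τ ^ j) c) * (τ ^ m) (∏ j ∈ Finset.Icc 1 k, (τ ^ j) c) := by
  induction k with
  | zero => simp
  | succ k ih =>
    rw [← add_assoc, Finset.prod_Icc_succ_top (by omega), ih,
      Finset.prod_Icc_succ_top (by omega), map_mul, ← RingAut.mul_apply (τ ^ m), ← pow_add,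
      add_assoc, mul_assoc]

/-- The shifted syndrome term splits into a factor depending on the error value `a` and one
depending on the locator `x`. -/
theorem pow_apply_syndrome_term {K : Type*} [Field K] (τ : K ≃+* K) {c : K} (hc : c ≠ 0)
    (a x : K) (m k : ℕ) :
    (τ ^ m) (a * (τ ^ k) x * ∏ j ∈ Finset.Icc 1 k, (τ ^ j) c) =
      (τ ^ m) a * (∏ j ∈ Finset.Icc 1 m, ((τ ^ j) c)⁻¹) *
        ((τ ^ (m + k)) x * ∏ j ∈ Finset.Icc 1 (m + k), (τ ^ j) c) := by
  have hne : ∏ j ∈ Finset.Icc 1 m, (τ ^ j) c ≠ 0 :=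
    Finset.prod_ne_zero_iff.2 fun j _ => (map_ne_zero (τ ^ j)).2 hc
  rw [prod_pow_apply_add, Finset.prod_inv_distrib, map_mul, map_mul, pow_add, RingAut.mul_apply]
  field_simp

/-- If `Λ` vanishes under operator evaluation at `x`, so does every shift of its reverse. -/
theorem sum_reverse_pow_apply_eq_zero {K : Type*} [Field K] (τ : K ≃+* K) (c x : K)
    (Λ : ℕ → K) (γ l : ℕ) (hl : γ + 1 ≤ l)
    (h : ∑ μ ∈ Finset.Icc 1 (γ + 1), Λ μ * (τ ^ (μ - 1)) x *
      ∏ j ∈ Finset.Icc 1 (μ - 1), (τ ^ j) c = 0) :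
    ∑ ν ∈ Finset.Icc 1 (γ + 1), (τ ^ (l - ν)) x * (∏ j ∈ Finset.Icc 1 (l - ν), (τ ^ j) c) *
      (τ ^ (l - γ - 1)) (Λ (γ + 2 - ν)) = 0 := by
  have h' := congrArg (fun y => (∏ j ∈ Finset.Icc 1 (l - γ - 1), (τ ^ j) c) *
    (τ ^ (l - γ - 1)) y) h
  simp only [map_zero, mul_zero, map_sum, Finset.mul_sum] at h'
  rw [← h']
  refine Finset.sum_nbij' (fun ν => γ + 2 - ν) (fun μ => γ + 2 - μ) ?_ ?_ ?_ ?_ ?_ <;>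
    intro ν hν <;> rw [Finset.mem_Icc] at hν
  · rw [Finset.mem_Icc]; omega
  · rw [Finset.mem_Icc]; omega
  · omega
  · omega
  · have e : l - ν = (l - γ - 1) + (γ + 2 - ν - 1) := by omega
    rw [e, prod_pow_apply_add, pow_add, RingAut.mul_apply, map_mul, map_mul]
    ring

/-- ESP key equation (Theorem 1).  For each block `i` the error indices are partitioned
into full errors `FS i`, row erasures `RS i` and column erasures `CS i`, of total sizes
`tF`, `ρ` and `γ`.  The sequence `lam` is the skew product (w.r.t. `σ⁻¹`) of `ΛF` and
`ΛR` (where `ΛR` vanishes outside `[1, ρ+1]`); assumption (i) says that `lam` vanishes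
under generalized operator evaluation (w.r.t. `σ⁻¹`, parameter `σ⁻¹(ξ_i⁻¹)`) at all error
values of full errors and row erasures, and assumption (ii) says that `ΛC` vanishes at
the error locators of the column erasures (parameter `σ⁻¹(ξ_i)`).  Then all coefficients
of index `l ≥ tF + ρ + γ + 1` of the skew product `ΛF · (ΛR · s · Λ̂C)` vanish, i.e. this
product is congruent mod `x^{n-k}` (from the right) to a skew polynomial of degree less
than `tF + ρ + γ`. -/
theorem esp_key_equation {K : Type*} [Field K] (σ : K ≃+* K)
    (ℓ : ℕ) (t : Fin ℓ → ℕ)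
    (ξ : Fin ℓ → K) (hξ : ∀ i, ξ i ≠ 0)
    (a x : (i : Fin ℓ) → Fin (t i) → K)
    (s : ℕ → K)
    (hs : ∀ l : ℕ, 1 ≤ l → s l =
      ∑ i, ∑ r, a i r * (σ.symm ^ (l - 1)) (x i r) *
        ∏ j ∈ Finset.Icc 1 (l - 1), (σ.symm ^ j) (ξ i))
    (FS RS CS : (i : Fin ℓ) → Finset (Fin (t i)))
    (hpart : ∀ i, FS i ∪ RS i ∪ CS i = Finset.univ)
    (hFR : ∀ i, Disjoint (FS i) (RS i))
    (hFC : ∀ i, Disjoint (FS i) (CS i))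
    (hRC : ∀ i, Disjoint (RS i) (CS i))
    (tF ρ γ : ℕ)
    (htF : tF = ∑ i, (FS i).card) (hρ : ρ = ∑ i, (RS i).card)
    (hγ : γ = ∑ i, (CS i).card)
    (ΛF ΛR ΛC lam : ℕ → K)
    (hΛR : ∀ μ : ℕ, μ = 0 ∨ ρ + 1 < μ → ΛR μ = 0)
    (hlam : ∀ ν ∈ Finset.Icc 1 (tF + ρ + 1),
      lam ν = ∑ μ ∈ Finset.Icc 1 (tF + 1), ΛF μ * (σ.symm ^ (μ - 1)) (ΛR (ν + 1 - μ)))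
    (hi : ∀ i, ∀ r ∈ FS i ∪ RS i,
      ∑ ν ∈ Finset.Icc 1 (tF + ρ + 1), lam ν * (σ.symm ^ (ν - 1)) (a i r) *
        ∏ j ∈ Finset.Icc 1 (ν - 1), ((σ.symm ^ j) (ξ i))⁻¹ = 0)
    (hii : ∀ i, ∀ r ∈ CS i,
      ∑ μ ∈ Finset.Icc 1 (γ + 1), ΛC μ * (σ.symm ^ (μ - 1)) (x i r) *
        ∏ j ∈ Finset.Icc 1 (μ - 1), (σ.symm ^ j) (ξ i) = 0)
    (u : ℕ → K)
    (hu : ∀ μ : ℕ, tF + ρ + 1 ≤ μ → u μ =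
      ∑ ν ∈ Finset.Icc 1 (tF + ρ + 1), lam ν * (σ.symm ^ (ν - 1)) (s (μ - ν + 1))) :
    ∀ l : ℕ, tF + ρ + γ + 1 ≤ l →
      ∑ ν ∈ Finset.Icc 1 (γ + 1),
        u (l - ν + 1) * (σ.symm ^ (l - γ - 1)) (ΛC (γ + 2 - ν)) = 0 := by
  intro l hl
  set A : (i : Fin ℓ) → Fin (t i) → K := fun i r =>
    ∑ ν ∈ Finset.Icc 1 (tF + ρ + 1), lam ν * (σ.symm ^ (ν - 1)) (a i r) *
      ∏ j ∈ Finset.Icc 1 (ν - 1), ((σ.symm ^ j) (ξ i))⁻¹ with hA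
  have hu' : ∀ μ : ℕ, tF + ρ + 1 ≤ μ → u μ = ∑ i, ∑ r, A i r *
      ((σ.symm ^ (μ - 1)) (x i r) * ∏ j ∈ Finset.Icc 1 (μ - 1), (σ.symm ^ j) (ξ i)) := by
    intro μ hμ
    simp only [hu μ hμ, hA, Finset.sum_mul]
    rw [Finset.sum_congr rfl fun i _ => Finset.sum_comm, Finset.sum_comm]
    refine Finset.sum_congr rfl fun ν hν => ?_
    rw [Finset.mem_Icc] at hν
    have e : μ - 1 = (ν - 1) + (μ - ν) := by omega
    rw [hs _ (by omega), Nat.add_sub_cancel, e]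
    simp only [map_sum, Finset.mul_sum]
    refine Finset.sum_congr rfl fun i _ => Finset.sum_congr rfl fun r _ => ?_
    rw [pow_apply_syndrome_term σ.symm (hξ i)]
    ring
  have hterm : ∀ ν ∈ Finset.Icc 1 (γ + 1),
      u (l - ν + 1) * (σ.symm ^ (l - γ - 1)) (ΛC (γ + 2 - ν)) =
        ∑ i, ∑ r, A i r * ((σ.symm ^ (l - ν)) (x i r) *
          (∏ j ∈ Finset.Icc 1 (l - ν), (σ.symm ^ j) (ξ i)) *
          (σ.symm ^ (l - γ - 1)) (ΛC (γ + 2 - ν))) := by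
    intro ν hν
    rw [Finset.mem_Icc] at hν
    rw [hu' _ (by omega), Nat.add_sub_cancel]
    simp only [Finset.sum_mul, mul_assoc]
  rw [Finset.sum_congr rfl hterm, Finset.sum_comm]
  refine Finset.sum_eq_zero fun i _ => ?_
  rw [Finset.sum_comm]
  refine Finset.sum_eq_zero fun r _ => ?_
  rw [← Finset.mul_sum]
  have hr : r ∈ FS i ∪ RS i ∪ CS i := hpart i ▸ Finset.mem_univ r
  rcases Finset.mem_union.1 hr with hr | hr
  · rw [show A i r = 0 from hi i r hr, zero_mul]
  · rw [sum_reverse_pow_apply_eq_zero σ.symm (ξ i) (x i r) ΛC γ l (by omega) (hii i r hr),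
      mul_zero]
end

section
/- Correctness of combined error–erasure decoding up to the decoding radius (core of Theorem 3): let C ⊆ K^n be a K-linear subspace all of whose nonzero elements have sum-rank weight at least 2·t_F + ρ + γ + 1 (i.e., a code of minimum sum-rank distance greater than 2·t_F + ρ + γ; for an MSRD code such as a linearized Reed–Solomon code of dimension k this holds whenever 2·t_F + ρ + γ ≤ n − k). Let c, c' ∈ C and suppose c + e_F + e_R + e_C = c' + e'_F + e'_R + e'_C, where, blockwise with respect to the length partition: (i) wt_ΣR(e_F) ≤ t_F and wt_ΣR(e'_F) ≤ t_F; (ii) for each i there is an F-subspace V_i ⊆ K with dim_F V_i ≤ ρ_i such that every entry of e_R^{(i)} and of e'^{(i)}_R lies in V_i, with ρ = Σ_i ρ_i; (iii) for each i there are vectors b_1^{(i)}, …, b_{γ_i}^{(i)} ∈ F^{n_i} such that both e_C^{(i)} and e'^{(i)}_C are K-linear combinations of b_1^{(i)}, …, b_{γ_i}^{(i)}, with γ = Σ_i γ_i. Then c = c'; in particular, a received word together with the row-erasure column spaces and column-erasure row spaces determines the transmitted codeword uniquely whenever 2·t_F + ρ + γ is less than the minimum sum-rank distance. -/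
/-- The fixed subfield `F = {c : K | σ c = c}` of the automorphism `σ`. -/
def fixedSubfield (K : Type*) [Field K] (σ : K ≃+* K) : Subfield K where
  carrier := {c | σ c = c}
  mul_mem' := by intro p q hp hq; simp only [Set.mem_setOf_eq, map_mul] at *; rw [hp, hq]
  one_mem' := map_one σ
  add_mem' := by intro p q hp hq; simp only [Set.mem_setOf_eq, map_add] at *; rw [hp, hq]
  zero_mem' := map_zero σ
  neg_mem' := by intro p hp; simp only [Set.mem_setOf_eq, map_neg] at *; rw [hp]
  inv_mem' := by intro p hp; simp only [Set.mem_setOf_eq, map_inv₀] at *; rw [hp]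

/-- The `F`-rank of a vector over `K`: the dimension over the fixed subfield `F` of the
`F`-linear span of its entries. -/
noncomputable def rankF {K : Type*} [Field K] (σ : K ≃+* K) {m : ℕ} (v : Fin m → K) : ℕ :=
  Module.finrank (fixedSubfield K σ)
    (Submodule.span (fixedSubfield K σ) (Set.range v))

section RankF

variable {K : Type*} [Field K] (σ : K ≃+* K) {m : ℕ}

/-- A vector with entries in a finite-dimensional `F`-subspace has `F`-rank at most its
dimension. -/
theorem rankF_le_finrank (W : Submodule (fixedSubfield K σ) K)
    [FiniteDimensional (fixedSubfield K σ) W] {v : Fin m → K} (hv : ∀ κ, v κ ∈ W) :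
    rankF σ v ≤ Module.finrank (fixedSubfield K σ) W :=
  Submodule.finrank_mono (Submodule.span_le.2 (Set.range_subset_iff.2 hv))

theorem rankF_le_of_rank_le {W : Submodule (fixedSubfield K σ) K} {r : ℕ}
    (hW : Module.rank (fixedSubfield K σ) W ≤ (r : Cardinal)) {v : Fin m → K}
    (hv : ∀ κ, v κ ∈ W) : rankF σ v ≤ r := by
  have : FiniteDimensional (fixedSubfield K σ) W :=
    Module.rank_lt_aleph0_iff.1 (hW.trans_lt Cardinal.natCast_lt_aleph0)
  refine (rankF_le_finrank σ W hv).trans ?_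
  rw [← Module.finrank_eq_rank] at hW
  exact_mod_cast hW

theorem rankF_add_le (u v : Fin m → K) : rankF σ (u + v) ≤ rankF σ u + rankF σ v := by
  have hu := FiniteDimensional.span_of_finite (fixedSubfield K σ) (Set.finite_range u)
  have hv := FiniteDimensional.span_of_finite (fixedSubfield K σ) (Set.finite_range v)
  exact (rankF_le_finrank σ (_ ⊔ _) fun κ =>
    Submodule.add_mem_sup (Submodule.subset_span (Set.mem_range_self κ))
      (Submodule.subset_span (Set.mem_range_self κ))).trans
    (Submodule.finrank_add_le_finrank_add_finrank _ _)

theorem rankF_neg_le (v : Fin m → K) : rankF σ (-v) ≤ rankF σ v := by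
  have hv := FiniteDimensional.span_of_finite (fixedSubfield K σ) (Set.finite_range v)
  exact rankF_le_finrank σ _ fun κ =>
    Submodule.neg_mem _ (Submodule.subset_span (Set.mem_range_self κ))

/-- A `K`-linear combination of `g` vectors over `F` has `F`-rank at most `g`. -/
theorem rankF_le_of_mem_span {g : ℕ} {b : Fin g → Fin m → K}
    (hb : ∀ j κ, σ (b j κ) = b j κ) {v : Fin m → K}
    (hv : v ∈ Submodule.span K (Set.range b)) : rankF σ v ≤ g := by
  obtain ⟨a, rfl⟩ := (Submodule.mem_span_range_iff_exists_fun K).1 hv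
  have ha := FiniteDimensional.span_of_finite (fixedSubfield K σ) (Set.finite_range a)
  refine (rankF_le_finrank σ (Submodule.span (fixedSubfield K σ) (Set.range a))
    fun κ => ?_).trans ((finrank_range_le_card a).trans_eq (Fintype.card_fin g))
  rw [Finset.sum_apply]
  refine Submodule.sum_mem _ fun j _ => ?_
  have hmem := Submodule.smul_mem _ (⟨b j κ, hb j κ⟩ : fixedSubfield K σ)
    (Submodule.subset_span (R := fixedSubfield K σ) (Set.mem_range_self (f := a) j))
  rwa [Subfield.smul_def, smul_eq_mul, mul_comm] at hmem

end RankF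

/-- Correctness of combined error–erasure decoding up to the decoding radius (core of
Theorem 3): if every nonzero element of the `K`-linear code `C` has sum-rank weight at
least `2 t_F + ρ + γ + 1`, and `c + e_F + e_R + e_C = c' + e'_F + e'_R + e'_C` for
codewords `c, c'` where the full-error parts have sum-rank weight at most `t_F`, the
row-erasure parts of block `i` have all entries in a common `F`-subspace `V_i ⊆ K` of
dimension at most `ρ_i`, and the column-erasure parts of block `i` are `K`-linear
combinations of common vectors `b_1^{(i)}, …, b_{γ_i}^{(i)} ∈ F^{n_i}`, then `c = c'`:
the received word together with the erasure side information determines the transmitted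
codeword uniquely. -/
theorem error_erasure_decoding_unique {K : Type*} [Field K] (σ : K ≃+* K)
    (ℓ : ℕ) (n : Fin ℓ → ℕ)
    (tF : ℕ) (ρi γi : Fin ℓ → ℕ)
    (C : Submodule K ((i : Fin ℓ) → Fin (n i) → K))
    (hdist : ∀ v ∈ C, v ≠ 0 →
      2 * tF + (∑ i, ρi i) + (∑ i, γi i) + 1 ≤ ∑ i, rankF σ (v i))
    (c c' : (i : Fin ℓ) → Fin (n i) → K) (hc : c ∈ C) (hc' : c' ∈ C)
    (eF eR eC eF' eR' eC' : (i : Fin ℓ) → Fin (n i) → K)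
    (heq : c + eF + eR + eC = c' + eF' + eR' + eC')
    (hF : ∑ i, rankF σ (eF i) ≤ tF) (hF' : ∑ i, rankF σ (eF' i) ≤ tF)
    (hR : ∀ i, ∃ V : Submodule (fixedSubfield K σ) K,
      Module.rank (fixedSubfield K σ) V ≤ (ρi i : Cardinal) ∧
      (∀ κ, eR i κ ∈ V) ∧ (∀ κ, eR' i κ ∈ V))
    (hC : ∀ i, ∃ b : Fin (γi i) → (Fin (n i) → K),
      (∀ j κ, σ (b j κ) = b j κ) ∧
      eC i ∈ Submodule.span K (Set.range b) ∧
      eC' i ∈ Submodule.span K (Set.range b)) :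
    c = c' := by
  by_contra hne
  have hw := hdist (c - c') (C.sub_mem hc hc') (sub_ne_zero.2 hne)
  have hblock : ∀ i, rankF σ ((c - c') i) ≤
      rankF σ (eF' i) + rankF σ (eF i) + ρi i + γi i := by
    intro i
    obtain ⟨V, hV, hRV, hRV'⟩ := hR i
    obtain ⟨b, hb, hCb, hCb'⟩ := hC i
    have hdecomp : (c - c') i =
        eF' i + -eF i + (eR' i - eR i) + (eC' i - eC i) := by
      have hi : c i + eF i + eR i + eC i = c' i + eF' i + eR' i + eC' i := congrFun heq i
      rw [Pi.sub_apply]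
      linear_combination hi
    rw [hdecomp]
    have hrow : rankF σ (eR' i - eR i) ≤ ρi i :=
      rankF_le_of_rank_le σ hV fun κ => V.sub_mem (hRV' κ) (hRV κ)
    have hcol : rankF σ (eC' i - eC i) ≤ γi i :=
      rankF_le_of_mem_span σ hb (Submodule.sub_mem _ hCb' hCb)
    have hneg := rankF_neg_le σ (eF i)
    have h₁ := rankF_add_le σ (eF' i + -eF i + (eR' i - eR i)) (eC' i - eC i)
    have h₂ := rankF_add_le σ (eF' i + -eF i) (eR' i - eR i)
    have h₃ := rankF_add_le σ (eF' i) (-eF i)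
    lia
  have hsum := Finset.sum_le_sum fun i (_ : i ∈ Finset.univ) => hblock i
  simp only [Finset.sum_add_distrib] at hsum
  lia
end
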